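/- Fix l ≥ 1, let Σ_S be given by an asynchronous state space system B_S of trajectories ℕ → Γ × X with external behavior B, and let Σ_S^{l↑} be the canonical state space system for B^{l↑}. If R_l^{-1} is an l-initial simulation relation from Σ_S^{l↑} to Σ_S, then B^{l↑} ⊆ B, hence B = B^{l↑}; in other words, the existence of an l-initial simulation relation from the abstraction back to the original system forces external behavioral equivalence. -/

import Mathlib

namespace LComplete

/-- The string `(γ s, γ (s+1), …, γ (s+len-1))`, i.e. the restriction `γ|[s, s+len-1]`. -/
def window {Γ : Type*} (γ : ℕ → Γ) (s len : ℕ) : List Γ :=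
  (List.range len).map fun i => γ (s + i)

/-- The set of restrictions `B|[s, s+len-1]` of all signals in the behavior `B`. -/
def windowSet {Γ : Type*} (B : Set (ℕ → Γ)) (s len : ℕ) : Set (List Γ) :=
  (fun γ => window γ s len) '' B

/-- `(Γ, B)` is asynchronously `m`-complete: a signal belongs to `B` iff its initial
string of length `m` is an initial string of `B` and every sliding window of length
`m+1` occurs somewhere in `B`. -/
def AsyncComplete {Γ : Type*} (m : ℕ) (B : Set (ℕ → Γ)) : Prop :=
  ∀ γ : ℕ → Γ,
    γ ∈ B ↔ (window γ 0 m ∈ windowSet B 0 m ∧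
      ∀ k : ℕ, ∃ k' : ℕ, window γ k (m + 1) ∈ windowSet B k' (m + 1))

/-- The behavior `B^{m↑}` of the strongest asynchronous `m`-complete approximation. -/
def lift {Γ : Type*} (m : ℕ) (B : Set (ℕ → Γ)) : Set (ℕ → Γ) :=
  { γ | window γ 0 m ∈ windowSet B 0 m ∧
      ∀ k : ℕ, ∃ k' : ℕ, window γ k (m + 1) ∈ windowSet B k' (m + 1) }

/-- The concatenation `w₁ ∧_{t₁}^{t₂} w₂`. -/
def concat {V : Type*} (w₁ w₂ : ℕ → V) (t₁ t₂ : ℕ) : ℕ → V :=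
  fun t => if t < t₁ then w₁ t else w₂ (t - t₁ + t₂)

/-- `BS` is an asynchronous state space system. -/
def IsAsyncSS {W X : Type*} (BS : Set ((ℕ → W) × (ℕ → X))) : Prop :=
  ∀ p ∈ BS, ∀ q ∈ BS, ∀ t₁ t₂ : ℕ, p.2 t₁ = q.2 t₂ →
    (concat p.1 q.1 t₁ t₂, concat p.2 q.2 t₁ t₂) ∈ BS

/-- State set `Z'` of the canonical state space system for `B'`. -/
def canonState {Γ : Type*} (l : ℕ) (B' : Set (ℕ → Γ)) : Set (List Γ) :=
  { ζ | (ζ.length < l ∧ ζ ∈ windowSet B' 0 ζ.length) ∨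
        (ζ.length = l ∧ ∃ k : ℕ, ζ ∈ windowSet B' k l) }

/-- Behavior `B'_S` of the canonical state space system for `B'`. -/
def canonBeh {Γ : Type*} (l : ℕ) (B' : Set (ℕ → Γ)) :
    Set ((ℕ → Γ) × (ℕ → List Γ)) :=
  { p | p.1 ∈ B' ∧
      ∀ k : ℕ, p.2 k = if k < l then window p.1 0 k else window p.1 (k - l) l }

/-- The external behavior of a state space behavior. -/
def extBeh {Γ X : Type*} (BS : Set ((ℕ → Γ) × (ℕ → X))) : Set (ℕ → Γ) :=
  { γ | ∃ x : ℕ → X, (γ, x) ∈ BS }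

/-- `R` is an `m`-initial simulation relation from the system with behavior `BS₁`
to the system with behavior `BS₂`. -/
def InitSim {Γ X₁ X₂ : Type*} (m : ℕ) (BS₁ : Set ((ℕ → Γ) × (ℕ → X₁)))
    (BS₂ : Set ((ℕ → Γ) × (ℕ → X₂))) (R : Set (X₁ × X₂)) : Prop :=
  (∀ p ∈ BS₁, ∃ q ∈ BS₂, (p.2 m, q.2 m) ∈ R) ∧
  (∀ p ∈ BS₁, ∀ q' ∈ BS₂, ∀ t₁ t₂ : ℕ, (p.2 t₁, q'.2 t₂) ∈ R →
    ∃ q ∈ BS₂,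
      q.1 = concat q'.1 p.1 t₂ t₁ ∧
      (∀ t ≤ t₂, q.2 t = q'.2 t) ∧
      ∀ j : ℕ, 1 ≤ j → (p.2 (t₁ + j), q.2 (t₂ + j)) ∈ R)

/-- `R` is a synchronous simulation relation from the system with behavior `BS₁`
to the system with behavior `BS₂`. -/
def SyncSim {Γ X₁ X₂ : Type*} (BS₁ : Set ((ℕ → Γ) × (ℕ → X₁)))
    (BS₂ : Set ((ℕ → Γ) × (ℕ → X₂))) (R : Set (X₁ × X₂)) : Prop :=
  (∀ t : ℕ, ∀ p ∈ BS₁, ∃ q ∈ BS₂, (p.2 t, q.2 t) ∈ R) ∧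
  (∀ p ∈ BS₁, ∀ q' ∈ BS₂, ∀ t : ℕ, (p.2 t, q'.2 t) ∈ R →
    ∃ q ∈ BS₂,
      q.1 = concat q'.1 p.1 t t ∧
      (∀ s ≤ t, q.2 s = q'.2 s) ∧
      ∀ j : ℕ, 1 ≤ j → (p.2 (t + j), q.2 (t + j)) ∈ R)

/-- `X^{k,ζ}`: states reached at time `k` with recent past `ζ`. -/
def reachAt {Γ X : Type*} (BS : Set ((ℕ → Γ) × (ℕ → X))) (k : ℕ) (ζ : List Γ) :
    Set X :=
  { ξ | ∃ p ∈ BS, p.2 k = ξ ∧ window p.1 (k - ζ.length) ζ.length = ζ }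

/-- `X_ζ`: states compatible with recent past `ζ`. -/
def reach {Γ X : Type*} (BS : Set ((ℕ → Γ) × (ℕ → X))) (ζ : List Γ) : Set X :=
  { ξ | ∃ k : ℕ, ζ.length ≤ k ∧ ξ ∈ reachAt BS k ζ }

/-- The relation `R₀ ⊆ X × Z'`. -/
def R0 {Γ X : Type*} (l : ℕ) (BS : Set ((ℕ → Γ) × (ℕ → X))) (B : Set (ℕ → Γ)) :
    Set (X × List Γ) :=
  { p | p.2 ∈ canonState l (lift l B) ∧
      ((p.2.length < l ∧ p.1 ∈ reachAt BS p.2.length p.2) ∨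
       (p.2.length = l ∧ p.1 ∈ reach BS p.2)) }

/-- The relation `R_l ⊆ X × Z'`. -/
def Rl {Γ X : Type*} (l : ℕ) (BS : Set ((ℕ → Γ) × (ℕ → X))) (B : Set (ℕ → Γ)) :
    Set (X × List Γ) :=
  { p | p.2 ∈ canonState l (lift l B) ∧ p.2.length = l ∧ p.1 ∈ reach BS p.2 }

/-- The relation `R_X ⊆ X × X`. -/
def RX {Γ X : Type*} (l : ℕ) (BS : Set ((ℕ → Γ) × (ℕ → X))) : Set (X × X) :=
  { p | ∃ ζ : List Γ, ζ.length = l ∧ p.1 ∈ reach BS ζ ∧ p.2 ∈ reach BS ζ }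

/-- The inverse of a relation. -/
def inv {X₁ X₂ : Type*} (R : Set (X₁ × X₂)) : Set (X₂ × X₁) :=
  { p | (p.2, p.1) ∈ R }

/-- The full behavior `B_f(P)` of a state machine `P = (X, W, δ, X₀)`. -/
def fullBeh {W X : Type*} (δ : Set (X × W × X)) (X₀ : Set X) :
    Set ((ℕ → W) × (ℕ → X)) :=
  { p | p.2 0 ∈ X₀ ∧ ∀ t : ℕ, (p.2 t, p.1 t, p.2 (t + 1)) ∈ δ }

/-- The transition relation `δ` of the canonical realization of `B'`. -/
def canonDelta {Γ : Type*} (l : ℕ) (B' : Set (ℕ → Γ)) :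
    Set (List Γ × Γ × List Γ) :=
  { t | (t.1.length < l ∧ t.2.2 = t.1 ++ [t.2.1] ∧
          t.1 ++ [t.2.1] ∈ windowSet B' 0 (t.1.length + 1)) ∨
        (t.1.length = l ∧ t.2.2 = t.1.tail ++ [t.2.1] ∧
          ∃ k' : ℕ, t.1 ++ [t.2.1] ∈ windowSet B' k' (l + 1)) }

end LComplete

namespace LComplete

@[simp]
theorem length_window {Γ : Type*} (γ : ℕ → Γ) (s len : ℕ) : (window γ s len).length = len := by
  simp [window]

theorem eq_of_window_zero_eq {Γ : Type*} {γ γ' : ℕ → Γ} {len : ℕ}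
    (h : window γ 0 len = window γ' 0 len) {t : ℕ} (ht : t < len) : γ t = γ' t := by
  simpa using List.map_inj_left.mp h t (List.mem_range.mpr ht)

theorem concat_eq_of_window_zero_eq {Γ : Type*} {γ γ' : ℕ → Γ} {l : ℕ}
    (h : window γ' 0 l = window γ 0 l) : concat γ' γ l l = γ := by
  funext t
  unfold concat
  split_ifs with ht
  · exact eq_of_window_zero_eq h ht
  · rw [Nat.sub_add_cancel (not_lt.mp ht)]

theorem subset_lift {Γ : Type*} (m : ℕ) (B : Set (ℕ → Γ)) : B ⊆ lift m B :=
  fun γ hγ => ⟨⟨γ, hγ, rfl⟩, fun k => ⟨k, γ, hγ, rfl⟩⟩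

/-- The states at time `l` of two trajectories with the same external string on `[0, l-1]` are
related by `R_l⁻¹`. -/
theorem mem_inv_Rl_of_window_zero_eq {Γ X : Type*} {l : ℕ}
    {BS : Set ((ℕ → Γ) × (ℕ → X))} {B : Set (ℕ → Γ)} {γ γ' : ℕ → Γ} {x : ℕ → X}
    (hγ : γ ∈ lift l B) (hx : (γ', x) ∈ BS) (h : window γ' 0 l = window γ 0 l) :
    (window γ 0 l, x l) ∈ inv (Rl l BS B) := by
  refine ⟨Or.inr ⟨length_window .., 0, γ, hγ, rfl⟩, length_window .., l, ?_, (γ', x), hx, rfl, ?_⟩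
  · simp
  · simpa using h

end LComplete

/-- if `R_l⁻¹` is an `l`-initial simulation relation from `Σ_S^{l↑}` to
`Σ_S`, then `B^{l↑} ⊆ B`, hence `B = B^{l↑}` (external behavioral equivalence). -/
theorem Rl_inv_initSim_extEq {Γ X : Type*} [Nonempty Γ] (l : ℕ) (hl : 1 ≤ l)
    (BS : Set ((ℕ → Γ) × (ℕ → X))) (hBS : LComplete.IsAsyncSS BS)
    (B : Set (ℕ → Γ)) (hB : B = LComplete.extBeh BS)
    (hsim : LComplete.InitSim l (LComplete.canonBeh l (LComplete.lift l B)) BS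
      (LComplete.inv (LComplete.Rl l BS B))) :
    LComplete.lift l B ⊆ B ∧ B = LComplete.lift l B := by
  have hsub : LComplete.lift l B ⊆ B := by
    intro γ hγ
    obtain ⟨γ', hγ', hw⟩ := hγ.1
    rw [hB] at hγ'
    obtain ⟨x, hx⟩ := hγ'
    let z : ℕ → List Γ := fun k =>
      if k < l then LComplete.window γ 0 k else LComplete.window γ (k - l) l
    have hz : z l = LComplete.window γ 0 l := by simp [z]
    obtain ⟨q, hq, hq_ext, -⟩ := hsim.2 (γ, z) ⟨hγ, fun _ => rfl⟩ (γ', x) hx l l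
      (by simpa only [hz] using LComplete.mem_inv_Rl_of_window_zero_eq hγ hx hw)
    rw [LComplete.concat_eq_of_window_zero_eq hw] at hq_ext
    rw [hB]
    exact ⟨q.2, hq_ext ▸ hq⟩
  exact ⟨hsub, (LComplete.subset_lift l B).antisymm hsub⟩
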